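/- Fix a > 0. Then s_β(β^{1/6}) → +∞ as β → 0⁺. -/

import Mathlib

/-- The scale function `s_β(x) = ∫_{-1}^{x} exp(-2 ∫₀ᵘ (1/4)(a - e^{v/β}) dv) du`. -/
noncomputable def scaleFun (a β x : ℝ) : ℝ :=
  ∫ u in (-1 : ℝ)..x, Real.exp (-2 * ∫ v in (0 : ℝ)..u, (1 / 4) * (a - Real.exp (v / β)))

open Filter Set Topology

theorem integral_drift (a u : ℝ) {β : ℝ} (hβ : β ≠ 0) :
    ∫ v in (0 : ℝ)..u, (1 / 4) * (a - Real.exp (v / β))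
      = (1 / 4) * (a * u - β * (Real.exp (u / β) - 1)) := by
  have h : IntervalIntegrable (fun v : ℝ => Real.exp (v / β)) MeasureTheory.volume 0 u :=
    (by fun_prop : Continuous fun v : ℝ => Real.exp (v / β)).intervalIntegrable _ _
  rw [intervalIntegral.integral_const_mul, intervalIntegral.integral_sub (by simp) h,
    intervalIntegral.integral_comp_div (fun v => Real.exp v) hβ, integral_exp]
  simp
  ring

theorem scaleFun_eq (a x : ℝ) {β : ℝ} (hβ : β ≠ 0) :
    scaleFun a β x = ∫ u in (-1 : ℝ)..x,
      Real.exp (-(a * u) / 2 + β / 2 * (Real.exp (u / β) - 1)) := by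
  unfold scaleFun
  congr 1
  ext u
  rw [integral_drift a u hβ]
  ring_nf

theorem scaleFun_lower_bound {a β x : ℝ} (ha : 0 ≤ a) (hβ : 0 < β) (hx : 0 ≤ x) :
    x / 2 * Real.exp (-(a * x) / 2 + β / 2 * (Real.exp (x / 2 / β) - 1)) ≤ scaleFun a β x := by
  rw [scaleFun_eq a x hβ.ne']
  have hcont : Continuous fun u : ℝ =>
      Real.exp (-(a * u) / 2 + β / 2 * (Real.exp (u / β) - 1)) := by fun_prop
  calc x / 2 * Real.exp (-(a * x) / 2 + β / 2 * (Real.exp (x / 2 / β) - 1))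
      = ∫ _ in (x / 2)..x, Real.exp (-(a * x) / 2 + β / 2 * (Real.exp (x / 2 / β) - 1)) := by
        rw [intervalIntegral.integral_const, smul_eq_mul]
        ring
    _ ≤ ∫ u in (x / 2)..x, Real.exp (-(a * u) / 2 + β / 2 * (Real.exp (u / β) - 1)) := by
        refine intervalIntegral.integral_mono_on (by linarith) (by simp)
          (hcont.intervalIntegrable _ _) fun u hu => ?_
        obtain ⟨h₁, h₂⟩ := hu
        gcongr
    _ ≤ _ := intervalIntegral.integral_mono_interval (by linarith) (by linarith) le_rfl
        (Eventually.of_forall fun u => (Real.exp_pos _).le) (hcont.intervalIntegrable _ _)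

theorem inv_le_scaleFun_pow_six {a t : ℝ} (ha : 0 ≤ a) (ht : 0 < t) (ht1 : t ≤ 1) :
    Real.exp (-(a + 1) / 2) / 32 * t⁻¹ ≤ scaleFun a (t ^ 6) t := by
  refine le_trans ?_ (scaleFun_lower_bound ha (pow_pos ht 6) ht.le)
  have hy : 0 ≤ t / 2 / t ^ 6 := by positivity
  have hquad : (t / 2 / t ^ 6) ^ 2 / 2 ≤ Real.exp (t / 2 / t ^ 6) := by
    simpa using Real.pow_div_factorial_le_exp _ hy 2
  have hgrowth : t⁻¹ ^ 4 / 16 ≤ t ^ 6 / 2 * Real.exp (t / 2 / t ^ 6) := by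
    calc t⁻¹ ^ 4 / 16 = t ^ 6 / 2 * ((t / 2 / t ^ 6) ^ 2 / 2) := by
          field_simp
          norm_num
      _ ≤ _ := by gcongr
  have hexponent : -(a + 1) / 2 + t⁻¹ ^ 4 / 16
      ≤ -(a * t) / 2 + t ^ 6 / 2 * (Real.exp (t / 2 / t ^ 6) - 1) := by
    have h6 : t ^ 6 ≤ 1 := pow_le_one₀ ht.le ht1
    nlinarith [mul_le_mul_of_nonneg_left ht1 ha]
  have hinv : t⁻¹ ≤ t⁻¹ ^ 3 := le_self_pow₀ ((one_le_inv₀ ht).2 ht1) (by norm_num)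
  have hexp : t⁻¹ ^ 4 / 16 ≤ Real.exp (t⁻¹ ^ 4 / 16) := by
    linarith [Real.add_one_le_exp (t⁻¹ ^ 4 / 16)]
  calc Real.exp (-(a + 1) / 2) / 32 * t⁻¹
      ≤ Real.exp (-(a + 1) / 2) / 32 * t⁻¹ ^ 3 := by gcongr
    _ = t / 2 * (Real.exp (-(a + 1) / 2) * (t⁻¹ ^ 4 / 16)) := by
        field_simp
        norm_num
    _ ≤ t / 2 * (Real.exp (-(a + 1) / 2) * Real.exp (t⁻¹ ^ 4 / 16)) := by gcongr
    _ ≤ _ := by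
        rw [← Real.exp_add]
        gcongr

theorem tendsto_rpow_nhdsGT_zero {r : ℝ} (hr : 0 < r) :
    Tendsto (fun β : ℝ => β ^ r) (𝓝[>] 0) (𝓝[>] 0) := by
  refine tendsto_nhdsWithin_iff.2 ⟨?_, ?_⟩
  · have h := (Real.continuousAt_rpow_const 0 r (Or.inr hr.le)).tendsto
    rw [Real.zero_rpow hr.ne'] at h
    exact h.mono_left nhdsWithin_le_nhds
  · filter_upwards [self_mem_nhdsWithin] with β hβ using Real.rpow_pos_of_pos hβ r

/-- `s_β(β^{1/6}) → +∞` as `β → 0⁺`. -/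
theorem scaleFun_at_l2_tendsto_atTop (a : ℝ) (ha : 0 < a) :
    Filter.Tendsto (fun β : ℝ => scaleFun a β (β ^ ((1 : ℝ) / 6)))
      (nhdsWithin 0 (Set.Ioi 0)) Filter.atTop := by
  have hpow : Tendsto (fun t : ℝ => scaleFun a (t ^ 6) t) (𝓝[>] 0) atTop := by
    refine tendsto_atTop_mono' _ ?_ (tendsto_inv_nhdsGT_zero.const_mul_atTop
      (by positivity : 0 < Real.exp (-(a + 1) / 2) / 32))
    filter_upwards [Ioc_mem_nhdsGT one_pos] with t ht
    exact inv_le_scaleFun_pow_six ha.le ht.1 ht.2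
  refine (hpow.comp (tendsto_rpow_nhdsGT_zero (by norm_num : (0 : ℝ) < 1 / 6))).congr' ?_
  filter_upwards [self_mem_nhdsWithin] with β hβ
  have hroot : (β ^ ((1 : ℝ) / 6)) ^ 6 = β := by
    rw [← Real.rpow_natCast, ← Real.rpow_mul (le_of_lt hβ)]
    norm_num
  simp only [Function.comp_apply, hroot]
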